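/- arXiv:2509.21409 — 14 statements merged into one kernel-verified Lean document; each statement's English description precedes it below -/
import Mathlib

section
/- Let I be an interval of the reals, f : I → I twice differentiable with 0 < f'(t) < 1 and f''(t) < 0 for all t in I, and let L be a fixed point of f in I with m = f'(L). For t₀ in I with t₀ ≠ L let t_n = f⁽ⁿ⁾(t₀) and define the candidate sequence c_n = |L − t_n| / mⁿ. If t₀ > L then (c_n) is monotonically decreasing in n; if t₀ < L then (c_n) is monotonically increasing in n. -/
open Filter Topology Set

/-- Mean value theorem on a convex set of reals, in product form. -/
theorem exists_sub_eq_deriv_mul_sub {I : Set ℝ} (hI : Convex ℝ I) {g g' : ℝ → ℝ}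
    (hg : ∀ t ∈ I, HasDerivAt g (g' t) t) {a b : ℝ} (ha : a ∈ I) (hb : b ∈ I) (hab : a < b) :
    ∃ c ∈ Ioo a b, c ∈ I ∧ g b - g a = g' c * (b - a) := by
  have hsub : Icc a b ⊆ I := hI.ordConnected.out ha hb
  obtain ⟨c, hc, h⟩ := exists_hasDerivAt_eq_slope g g' hab
    (fun x hx => (hg x (hsub hx)).continuousAt.continuousWithinAt)
    (fun x hx => hg x (hsub (Ioo_subset_Icc_self hx)))
  refine ⟨c, hc, hsub (Ioo_subset_Icc_self hc), ?_⟩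
  rw [h, div_mul_cancel₀ _ (sub_pos.2 hab).ne']

/-- A function with negative derivative on a convex set of reals is strictly decreasing there. -/
theorem strictAntiOn_of_hasDerivAt_neg {I : Set ℝ} (hI : Convex ℝ I) {g g' : ℝ → ℝ}
    (hg : ∀ t ∈ I, HasDerivAt g (g' t) t) (hg' : ∀ t ∈ I, g' t < 0) : StrictAntiOn g I := by
  intro a ha b hb hab
  obtain ⟨c, -, hcI, h⟩ := exists_sub_eq_deriv_mul_sub hI hg ha hb hab
  have := mul_neg_of_neg_of_pos (hg' c hcI) (sub_pos.2 hab)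
  linarith

/-- Monotonicity of candidate sequences for root-like functions. -/
theorem stmt1 (I : Set ℝ) (hI : Convex ℝ I) (f f' f'' : ℝ → ℝ)
    (hmaps : Set.MapsTo f I I)
    (hd1 : ∀ t ∈ I, HasDerivAt f (f' t) t)
    (hd2 : ∀ t ∈ I, HasDerivAt f' (f'' t) t)
    (hf'pos : ∀ t ∈ I, 0 < f' t) (hf'lt : ∀ t ∈ I, f' t < 1)
    (hf'' : ∀ t ∈ I, f'' t < 0)
    (L : ℝ) (hL : L ∈ I) (hfix : f L = L)
    (m : ℝ) (hm : m = f' L)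
    (t₀ : ℝ) (ht₀ : t₀ ∈ I) (hne : t₀ ≠ L) :
    (t₀ > L → Antitone (fun n : ℕ => |L - f^[n] t₀| / m ^ n)) ∧
    (t₀ < L → Monotone (fun n : ℕ => |L - f^[n] t₀| / m ^ n)) := by
  have hmpos : 0 < m := hm ▸ hf'pos L hL
  have hanti := strictAntiOn_of_hasDerivAt_neg hI hd2 hf''
  constructor
  · intro h₀
    have step : ∀ x ∈ I, L < x → L < f x ∧ f x - L ≤ m * (x - L) := by
      intro x hx hLx
      obtain ⟨c, hc, hcI, h⟩ := exists_sub_eq_deriv_mul_sub hI hd1 hL hx hLx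
      rw [hfix] at h
      have hpos := mul_pos (hf'pos c hcI) (sub_pos.2 hLx)
      refine ⟨by linarith, ?_⟩
      rw [h, hm]
      exact mul_le_mul_of_nonneg_right (hanti hL hcI hc.1).le (sub_pos.2 hLx).le
    have orbit : ∀ n, f^[n] t₀ ∈ I ∧ L < f^[n] t₀ := by
      intro n
      induction n with
      | zero => exact ⟨ht₀, h₀⟩
      | succ n ih =>
        rw [Function.iterate_succ_apply']
        exact ⟨hmaps ih.1, (step _ ih.1 ih.2).1⟩
    refine antitone_nat_of_succ_le fun n => ?_
    obtain ⟨hxI, hLx⟩ := orbit n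
    obtain ⟨hLf, hle⟩ := step _ hxI hLx
    rw [Function.iterate_succ_apply', abs_sub_comm, abs_of_pos (sub_pos.2 hLf), abs_sub_comm,
      abs_of_pos (sub_pos.2 hLx), pow_succ', ← div_div]
    gcongr
    rwa [div_le_iff₀' hmpos]
  · intro h₀
    have step : ∀ x ∈ I, x < L → f x < L ∧ m * (L - x) ≤ L - f x := by
      intro x hx hxL
      obtain ⟨c, hc, hcI, h⟩ := exists_sub_eq_deriv_mul_sub hI hd1 hx hL hxL
      rw [hfix] at h
      have hpos := mul_pos (hf'pos c hcI) (sub_pos.2 hxL)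
      refine ⟨by linarith, ?_⟩
      rw [h, hm]
      exact mul_le_mul_of_nonneg_right (hanti hcI hL hc.2).le (sub_pos.2 hxL).le
    have orbit : ∀ n, f^[n] t₀ ∈ I ∧ f^[n] t₀ < L := by
      intro n
      induction n with
      | zero => exact ⟨ht₀, h₀⟩
      | succ n ih =>
        rw [Function.iterate_succ_apply']
        exact ⟨hmaps ih.1, (step _ ih.1 ih.2).1⟩
    refine monotone_nat_of_le_succ fun n => ?_
    obtain ⟨hxI, hxL⟩ := orbit n
    obtain ⟨hfL, hle⟩ := step _ hxI hxL
    rw [Function.iterate_succ_apply', abs_of_pos (sub_pos.2 hxL), abs_of_pos (sub_pos.2 hfL),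
      pow_succ', ← div_div]
    gcongr
    rwa [le_div_iff₀' hmpos]
end

section
/- Let I be an interval of the reals, f : I → I twice differentiable with 0 < f'(t) < 1 and f''(t) < 0 for all t in I, and let L be a fixed point of f in the interior of I with m = f'(L). If for some t₀ ∈ I with t₀ < L the candidate sequence |L − f⁽ⁿ⁾(t₀)| / mⁿ converges to a finite positive limit, then for every s₀ ∈ I with s₀ < L the candidate sequence |L − f⁽ⁿ⁾(s₀)| / mⁿ converges to a finite positive limit. Likewise, if for some t₀ ∈ I with t₀ > L the candidate sequence converges to a finite positive limit, then it does so for every s₀ ∈ I with s₀ > L. -/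
open Filter Topology Set

/-- Mean value bounds for a function whose derivative is strictly decreasing. -/
lemma slope_bounds {I : Set ℝ} (hI : Convex ℝ I) {f f' f'' : ℝ → ℝ}
    (hd1 : ∀ t ∈ I, HasDerivAt f (f' t) t) (hd2 : ∀ t ∈ I, HasDerivAt f' (f'' t) t)
    (hf'' : ∀ t ∈ I, f'' t < 0) {x y : ℝ} (hx : x ∈ I) (hy : y ∈ I) (hxy : x < y) :
    f' y * (y - x) < f y - f x ∧ f y - f x < f' x * (y - x) := by
  have hsub : Icc x y ⊆ I := hI.ordConnected.out hx hy
  have hanti : StrictAntiOn f' I := by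
    refine strictAntiOn_of_deriv_neg hI (fun t ht => (hd2 t ht).continuousAt.continuousWithinAt) ?_
    intro t ht
    rw [(hd2 t (interior_subset ht)).deriv]
    exact hf'' t (interior_subset ht)
  obtain ⟨c, hc, hcs⟩ := exists_hasDerivAt_eq_slope f f' hxy
    (fun t ht => (hd1 t (hsub ht)).continuousAt.continuousWithinAt)
    (fun t ht => hd1 t (hsub (Ioo_subset_Icc_self ht)))
  have hcI : c ∈ I := hsub (Ioo_subset_Icc_self hc)
  have hpos : 0 < y - x := sub_pos.2 hxy
  rw [eq_div_iff hpos.ne'] at hcs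
  rw [← hcs]
  exact ⟨mul_lt_mul_of_pos_right (hanti hcI hy hc.2) hpos,
    mul_lt_mul_of_pos_right (hanti hx hcI hc.1) hpos⟩

lemma monotoneOn_iterate {I : Set ℝ} {f : ℝ → ℝ} (hmaps : MapsTo f I I) (hf : MonotoneOn f I)
    (n : ℕ) : MonotoneOn f^[n] I := by
  induction n with
  | zero => exact fun x _ y _ h => h
  | succ n ih =>
    intro x hx y hy h
    exact ih (hmaps hx) (hmaps hy) (hf hx hy h)

lemma exists_iterate_ge {f : ℝ → ℝ} {L q s t : ℝ} (hq0 : 0 ≤ q) (hq1 : q < 1) (ht : t < L)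
    (h : ∀ n : ℕ, L - f^[n] s ≤ q ^ n * (L - s)) : ∃ k : ℕ, t ≤ f^[k] s := by
  have hlim : Tendsto (fun n : ℕ => q ^ n * (L - s)) atTop (𝓝 0) := by
    simpa using (tendsto_pow_atTop_nhds_zero_of_lt_one hq0 hq1).mul_const (L - s)
  obtain ⟨k, hk⟩ := (hlim.eventually (gt_mem_nhds (sub_pos.2 ht))).exists
  exact ⟨k, by linarith [h k]⟩

lemma exists_iterate_le {f : ℝ → ℝ} {L q s t : ℝ} (hq0 : 0 ≤ q) (hq1 : q < 1) (ht : L < t)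
    (h : ∀ n : ℕ, f^[n] s - L ≤ q ^ n * (s - L)) : ∃ k : ℕ, f^[k] s ≤ t := by
  have hlim : Tendsto (fun n : ℕ => q ^ n * (s - L)) atTop (𝓝 0) := by
    simpa using (tendsto_pow_atTop_nhds_zero_of_lt_one hq0 hq1).mul_const (s - L)
  obtain ⟨k, hk⟩ := (hlim.eventually (gt_mem_nhds (sub_pos.2 ht))).exists
  exact ⟨k, by linarith [h k]⟩


/-- Proper convergence of a candidate sequence for one initial value on a given
side of the fixed point implies proper convergence for all initial values on
that side. -/
theorem stmt2 (I : Set ℝ) (hI : Convex ℝ I) (f f' f'' : ℝ → ℝ)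
    (hmaps : Set.MapsTo f I I)
    (hd1 : ∀ t ∈ I, HasDerivAt f (f' t) t)
    (hd2 : ∀ t ∈ I, HasDerivAt f' (f'' t) t)
    (hf'pos : ∀ t ∈ I, 0 < f' t) (hf'lt : ∀ t ∈ I, f' t < 1)
    (hf'' : ∀ t ∈ I, f'' t < 0)
    (L : ℝ) (hL : L ∈ interior I) (hfix : f L = L)
    (m : ℝ) (hm : m = f' L) :
    ((∃ t₀ ∈ I, t₀ < L ∧ ∃ M > 0,
        Tendsto (fun n : ℕ => |L - f^[n] t₀| / m ^ n) atTop (𝓝 M)) →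
      ∀ s₀ ∈ I, s₀ < L → ∃ M > 0,
        Tendsto (fun n : ℕ => |L - f^[n] s₀| / m ^ n) atTop (𝓝 M)) ∧
    ((∃ t₀ ∈ I, L < t₀ ∧ ∃ M > 0,
        Tendsto (fun n : ℕ => |L - f^[n] t₀| / m ^ n) atTop (𝓝 M)) →
      ∀ s₀ ∈ I, L < s₀ → ∃ M > 0,
        Tendsto (fun n : ℕ => |L - f^[n] s₀| / m ^ n) atTop (𝓝 M)) := by
  have hLI : L ∈ I := interior_subset hL
  have hm0 : 0 < m := hm ▸ hf'pos L hLI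
  have hm1 : m < 1 := hm ▸ hf'lt L hLI
  have hslope : ∀ {x y : ℝ}, x ∈ I → y ∈ I → x < y →
      f' y * (y - x) < f y - f x ∧ f y - f x < f' x * (y - x) :=
    fun hx hy hxy => slope_bounds hI hd1 hd2 hf'' hx hy hxy
  have hmono : MonotoneOn f I := by
    intro x hx y hy hxy
    rcases hxy.eq_or_lt with rfl | hlt
    · exact le_rfl
    · have h1 := (hslope hx hy hlt).1
      have h2 := mul_pos (hf'pos y hy) (sub_pos.2 hlt)
      linarith
  have hiter := monotoneOn_iterate hmaps hmono
  have hmem : ∀ n : ℕ, ∀ {s : ℝ}, s ∈ I → f^[n] s ∈ I := fun n _ hs => hmaps.iterate n hs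
  constructor
  · rintro ⟨t₀, ht₀, ht₀L, M, -, hM⟩ s₀ hs₀ hs₀L
    have hlt : ∀ n : ℕ, ∀ {s : ℝ}, s ∈ I → s < L → f^[n] s < L := by
      intro n s hs hsL
      induction n with
      | zero => exact hsL
      | succ n ih =>
        rw [Function.iterate_succ_apply']
        have h1 := (hslope (hmem n hs) hLI ih).1
        have h2 := mul_pos (hf'pos L hLI) (sub_pos.2 ih)
        linarith
    have hcmono : ∀ {s : ℝ}, s ∈ I → s < L → Monotone fun n : ℕ => |L - f^[n] s| / m ^ n := by
      intro s hs hsL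
      refine monotone_nat_of_le_succ fun n => ?_
      rw [abs_of_pos (sub_pos.2 (hlt n hs hsL)), abs_of_pos (sub_pos.2 (hlt (n + 1) hs hsL)),
        div_le_div_iff₀ (pow_pos hm0 n) (pow_pos hm0 (n + 1)), Function.iterate_succ_apply', pow_succ]
      have h1 := (hslope (hmem n hs) hLI (hlt n hs hsL)).1
      rw [← hm, hfix] at h1
      have h2 := mul_le_mul_of_nonneg_right h1.le (pow_pos hm0 n).le
      linarith
    have hgeom : ∀ n : ℕ, s₀ ≤ f^[n] s₀ ∧ L - f^[n] s₀ ≤ f' s₀ ^ n * (L - s₀) := by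
      intro n
      induction n with
      | zero => simp
      | succ n ih =>
        rw [Function.iterate_succ_apply']
        have hx := hmem n hs₀
        have hxL := sub_pos.2 (hlt n hs₀ hs₀L)
        have h1 := (hslope hx hLI (hlt n hs₀ hs₀L)).2
        rw [hfix] at h1
        have hfx : f' (f^[n] s₀) ≤ f' s₀ := by
          rcases ih.1.eq_or_lt with he | hl
          · rw [← he]
          · have h3 := hslope hs₀ hx hl
            exact (lt_of_mul_lt_mul_right (h3.1.trans h3.2) (sub_pos.2 hl).le).le
        have h4 := mul_lt_mul_of_pos_right (hf'lt _ hx) hxL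
        refine ⟨by linarith [ih.1], ?_⟩
        have h5 := mul_le_mul_of_nonneg_right hfx hxL.le
        have h6 := mul_le_mul_of_nonneg_left ih.2 (hf'pos s₀ hs₀).le
        rw [pow_succ]
        linarith
    obtain ⟨k, hk⟩ := exists_iterate_ge (hf'pos s₀ hs₀).le (hf'lt s₀ hs₀) ht₀L fun n => (hgeom n).2
    have hbdd : BddAbove (range fun n : ℕ => |L - f^[n] s₀| / m ^ n) := by
      refine ⟨M / m ^ k, ?_⟩
      rintro _ ⟨n, rfl⟩
      refine (hcmono hs₀ hs₀L (Nat.le_add_right n k)).trans ?_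
      have h1 := (hcmono ht₀ ht₀L).ge_of_tendsto hM n
      have h2 := hiter n ht₀ (hmem k hs₀) hk
      rw [← Function.iterate_add_apply] at h2
      dsimp only at h1 ⊢
      rw [pow_add, ← div_div]
      refine div_le_div_of_nonneg_right (le_trans ?_ h1) (pow_pos hm0 k).le
      refine div_le_div_of_nonneg_right ?_ (pow_pos hm0 n).le
      rw [abs_of_pos (sub_pos.2 (hlt (n + k) hs₀ hs₀L)), abs_of_pos (sub_pos.2 (hlt n ht₀ ht₀L))]
      linarith
    refine ⟨_, ?_, tendsto_atTop_ciSup (hcmono hs₀ hs₀L) hbdd⟩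
    refine lt_of_lt_of_le ?_ (le_ciSup hbdd 0)
    simpa [sub_eq_zero] using hs₀L.ne'
  · rintro ⟨t₀, ht₀, ht₀L, M, hMpos, hM⟩ s₀ hs₀ hs₀L
    have hlt : ∀ n : ℕ, ∀ {s : ℝ}, s ∈ I → L < s → L < f^[n] s := by
      intro n s hs hsL
      induction n with
      | zero => exact hsL
      | succ n ih =>
        rw [Function.iterate_succ_apply']
        have h1 := (hslope hLI (hmem n hs) ih).1
        have h2 := mul_pos (hf'pos _ (hmem n hs)) (sub_pos.2 ih)
        linarith
    have habs : ∀ n : ℕ, ∀ {s : ℝ}, s ∈ I → L < s → |L - f^[n] s| = f^[n] s - L := by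
      intro n s hs hsL
      rw [abs_sub_comm, abs_of_pos (sub_pos.2 (hlt n hs hsL))]
    have hcanti : ∀ {s : ℝ}, s ∈ I → L < s → Antitone fun n : ℕ => |L - f^[n] s| / m ^ n := by
      intro s hs hsL
      refine antitone_nat_of_succ_le fun n => ?_
      rw [habs n hs hsL, habs (n + 1) hs hsL,
        div_le_div_iff₀ (pow_pos hm0 (n + 1)) (pow_pos hm0 n), Function.iterate_succ_apply', pow_succ]
      have h1 := (hslope hLI (hmem n hs) (hlt n hs hsL)).2
      rw [← hm, hfix] at h1
      have h2 := mul_le_mul_of_nonneg_right h1.le (pow_pos hm0 n).le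
      linarith
    obtain ⟨k, hk⟩ : ∃ k : ℕ, f^[k] t₀ ≤ s₀ := by
      refine exists_iterate_le hm0.le hm1 hs₀L fun n => ?_
      have h := hcanti ht₀ ht₀L (Nat.zero_le n)
      dsimp only at h
      rw [habs n ht₀ ht₀L, habs 0 ht₀ ht₀L, div_le_iff₀ (pow_pos hm0 n)] at h
      simpa [mul_comm] using h
    have hbound : ∀ n : ℕ, M * m ^ k ≤ |L - f^[n] s₀| / m ^ n := by
      intro n
      have h1 := (hcanti ht₀ ht₀L).le_of_tendsto hM (n + k)
      have h2 := hiter n (hmem k ht₀) hs₀ hk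
      rw [← Function.iterate_add_apply] at h2
      rw [habs _ ht₀ ht₀L, le_div_iff₀ (pow_pos hm0 _), pow_add] at h1
      rw [habs n hs₀ hs₀L, le_div_iff₀ (pow_pos hm0 n)]
      linarith
    have hbdd : BddBelow (range fun n : ℕ => |L - f^[n] s₀| / m ^ n) :=
      ⟨M * m ^ k, by rintro _ ⟨n, rfl⟩; exact hbound n⟩
    exact ⟨_, (mul_pos hMpos (pow_pos hm0 k)).trans_le (le_ciInf hbound),
      tendsto_atTop_ciInf (hcanti hs₀ hs₀L) hbdd⟩
end

section
/- Let Q(t) = (a t + b)/(t + d) be a Möbius function (a, b, d real with b ≠ a·d) whose fixed point equation aL + b = L(L + d) has two distinct real solutions, and let L be the greater solution; assume L > 0 and that m := (a·d − b)/(L + d)² lies in (0,1). Then for every n ≥ 1 and every real t for which all the iterates Q(t), Q⁽²⁾(t), …, Q⁽ⁿ⁾(t) are defined (no iterate equals the pole −d), the n-th iterate satisfies Q⁽ⁿ⁾(t) = (b·(t − L)·mⁿ + L·(b + L·t)) / (L·(L − t)·mⁿ + (b + L·t)). -/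
open Filter Topology

/-- If `L` and `L'` are the fixed points of `x ↦ (a * x + b) / (x + d)` and `m = (L' + d) / (L + d)`,
then the iterates of this map, as long as they avoid the pole, have the projective coordinates
`(L * (t - L') - L' * (t - L) * m ^ n : (t - L') - (t - L) * m ^ n)`. -/
theorem moebius_iterate_eq_div {K : Type*} [Field K] {a b d L L' m : K}
    (hL : a * L + b = L * (L + d)) (hL' : a * L' + b = L' * (L' + d)) (hne : L ≠ L')
    (hLd : L + d ≠ 0) (hm : m * (L + d) = L' + d) (n : ℕ) (t : K)
    (ht : ∀ k < n, (fun x => (a * x + b) / (x + d))^[k] t ≠ -d) :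
    (t - L') - (t - L) * m ^ n ≠ 0 ∧
      (fun x => (a * x + b) / (x + d))^[n] t =
        (L * (t - L') - L' * (t - L) * m ^ n) / ((t - L') - (t - L) * m ^ n) := by
  induction n with
  | zero =>
    have h : (t - L') - (t - L) * m ^ 0 = L - L' := by ring
    have h0 : L - L' ≠ 0 := sub_ne_zero.2 hne
    refine ⟨h ▸ h0, ?_⟩
    rw [h, eq_div_iff h0, Function.iterate_zero_apply]
    ring
  | succ n ih =>
    obtain ⟨hD, hx⟩ := ih fun k hk => ht k (hk.trans n.lt_succ_self)
    have hpole := ht n n.lt_succ_self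
    rw [Function.iterate_succ_apply']
    set x := (fun x => (a * x + b) / (x + d))^[n] t
    rw [eq_div_iff hD] at hx
    have hxd : x + d ≠ 0 := fun h => hpole (eq_neg_of_add_eq_zero_left h)
    have hden : (x + d) * ((t - L') - (t - L) * m ^ n) =
        (L + d) * ((t - L') - (t - L) * m ^ (n + 1)) := by
      linear_combination hx + (t - L) * m ^ n * hm
    have hnum : (a * x + b) * ((t - L') - (t - L) * m ^ n) =
        (L + d) * (L * (t - L') - L' * (t - L) * m ^ (n + 1)) := by
      linear_combination a * hx + L' * (t - L) * m ^ n * hm + (t - L') * hL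
        - (t - L) * m ^ n * hL'
    refine ⟨right_ne_zero_of_mul (hden ▸ mul_ne_zero hxd hD), ?_⟩
    rw [← mul_div_mul_right _ _ hD, hden, hnum, mul_div_mul_left _ _ hLd]

/-- Explicit formula for the n-th iterate of a Q-function. -/
theorem stmt5 (a b d L m : ℝ) (hab : b ≠ a * d)
    (Q : ℝ → ℝ) (hQ : Q = fun t => (a * t + b) / (t + d))
    (hLfix : a * L + b = L * (L + d))
    (hdist : ∃ L' : ℝ, L' < L ∧ a * L' + b = L' * (L' + d))
    (hLpos : 0 < L)
    (hm : m = (a * d - b) / (L + d) ^ 2) (hm0 : 0 < m) (hm1 : m < 1) :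
    ∀ n : ℕ, 1 ≤ n → ∀ t : ℝ, (∀ k < n, Q^[k] t ≠ -d) →
      Q^[n] t = (b * (t - L) * m ^ n + L * (b + L * t)) /
        (L * (L - t) * m ^ n + (b + L * t)) := by
  intro n _ t ht
  obtain ⟨L', hlt, hL'⟩ := hdist
  subst hQ
  have hLd : L + d ≠ 0 := by
    intro h
    simp [hm, h] at hm0
  have ha : a = L + L' + d :=
    mul_left_cancel₀ (sub_ne_zero.2 hlt.ne') (by linear_combination hLfix - hL')
  have hb : b = -(L * L') := by linear_combination hLfix - L * ha
  have hm' : m * (L + d) = L' + d := by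
    rw [hm, ha, hb]
    field_simp
    ring
  rw [(moebius_iterate_eq_div hLfix hL' hlt.ne' hLd hm' n t ht).2,
    ← mul_div_mul_left _ _ hLpos.ne', hb]
  congr 1 <;> ring
end

section
/- Let Q(t) = (a t + b)/(t + d) be a Möbius function (b ≠ a·d) which is a contraction on an interval I containing a fixed point L in its interior, with L > 0, Q strictly increasing and strictly concave on I, and m := Q'(L) ∈ (0,1). Then for every t₀ ∈ I with t₀ ≠ L, the candidate sequence c_n = |L − Q⁽ⁿ⁾(t₀)| / mⁿ converges, and its limit is |(L² + b)(L − t₀)/(b + L·t₀)|, which is finite and positive. -/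
open Filter Topology Set

/-- The derivative of a Möbius function at a fixed point `L` that is not its pole. -/
theorem deriv_moebius_of_fixed {a b d L : ℝ} (hLd : L + d ≠ 0)
    (hfix : a * L + b = L * (L + d)) :
    deriv (fun t : ℝ => (a * t + b) / (t + d)) L = (a - L) / (L + d) := by
  have h := (((hasDerivAt_id L).const_mul a).add_const b).div
    ((hasDerivAt_id L).add_const d) hLd
  refine h.deriv.trans ?_
  simp only [id]
  field_simp
  linear_combination -hfix

theorem moebius_sub_fixed {a b d L t : ℝ} (htd : t + d ≠ 0)
    (hfix : a * L + b = L * (L + d)) :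
    (a * t + b) / (t + d) - L = (a - L) * (t - L) / (t + d) := by
  field_simp
  linear_combination hfix

theorem add_mul_moebius {a b d L t : ℝ} (htd : t + d ≠ 0)
    (hfix : a * L + b = L * (L + d)) :
    b + L * ((a * t + b) / (t + d)) = (L + d) * (b + L * t) / (t + d) := by
  field_simp
  linear_combination t * hfix

/-- A Möbius function that strictly decreases distances to a fixed point `L` on a convex set
containing `L`, and has nonzero multiplier there, has no pole in that set. -/
theorem add_ne_zero_of_contracting {a b d L m : ℝ} {I : Set ℝ} (hI : Convex ℝ I)
    (hLI : L ∈ I) (hLd : L + d ≠ 0) (hfix : a * L + b = L * (L + d))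
    (hm : m = (a - L) / (L + d)) (hm0 : 0 < m) (hm1 : m < 1)
    (hlt : ∀ x ∈ I, x ≠ L → |(a * x + b) / (x + d) - L| < |x - L|) :
    ∀ t ∈ I, t + d ≠ 0 := by
  intro t ht htd
  have hx : (1 - m) • t + m • L ∈ I := hI ht hLI (by linarith) hm0.le (by ring)
  simp only [smul_eq_mul] at hx
  have hxd : (1 - m) * t + m * L + d = m * (L + d) := by linear_combination (1 - m) * htd
  have hxd0 : (1 - m) * t + m * L + d ≠ 0 := hxd ▸ mul_ne_zero hm0.ne' hLd
  have hxL : (1 - m) * t + m * L ≠ L := by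
    intro h
    have : (1 - m) * (L + d) = 0 := by linear_combination (1 - m) * htd - h
    rcases mul_eq_zero.1 this with h | h
    · linarith
    · exact hLd h
  have h := hlt _ hx hxL
  have haL : a - L = m * (L + d) := by rw [hm]; field_simp
  rw [moebius_sub_fixed hxd0 hfix, haL, ← hxd, mul_div_cancel_left₀ _ hxd0] at h
  exact lt_irrefl _ h


/-- Candidate sequences for Q-functions converge properly, with an explicit
limit. -/
theorem stmt6 (a b d : ℝ) (hab : b ≠ a * d)
    (Q : ℝ → ℝ) (hQ : Q = fun t => (a * t + b) / (t + d))
    (I : Set ℝ) (hI : Convex ℝ I) (hmaps : Set.MapsTo Q I I)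
    (k : ℝ) (hk : k < 1) (hcontr : ∀ x ∈ I, ∀ y ∈ I, |Q x - Q y| ≤ k * |x - y|)
    (L : ℝ) (hL : L ∈ interior I) (hLpos : 0 < L) (hfix : Q L = L)
    (hmono : StrictMonoOn Q I) (hconc : StrictConcaveOn ℝ I Q)
    (m : ℝ) (hm : m = deriv Q L) (hm0 : 0 < m) (hm1 : m < 1) :
    ∀ t₀ ∈ I, t₀ ≠ L →
      Tendsto (fun n : ℕ => |L - Q^[n] t₀| / m ^ n) atTop
        (𝓝 |(L ^ 2 + b) * (L - t₀) / (b + L * t₀)|) ∧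
      0 < |(L ^ 2 + b) * (L - t₀) / (b + L * t₀)| := by
  have hLI : L ∈ I := interior_subset hL
  subst hQ
  have hLd : L + d ≠ 0 := by
    intro h
    simp only [h, div_zero] at hfix
    exact hLpos.ne hfix
  have hfix' : a * L + b = L * (L + d) := by
    have h := hfix
    simp only at h
    rwa [div_eq_iff hLd] at h
  have hm' : m = (a - L) / (L + d) := hm.trans (deriv_moebius_of_fixed hLd hfix')
  have haL : a - L = m * (L + d) := by rw [hm']; field_simp
  have hlt : ∀ x ∈ I, x ≠ L → |(a * x + b) / (x + d) - L| < |x - L| := by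
    intro x hx hxL
    have h := hcontr x hx L hLI
    rw [hfix] at h
    have hpos : 0 < |x - L| := abs_pos.2 (sub_ne_zero.2 hxL)
    exact h.trans_lt (by nlinarith)
  have hpole := add_ne_zero_of_contracting hI hLI hLd hfix' hm' hm0 hm1 hlt
  have hLb : L ^ 2 + b ≠ 0 := by
    intro h
    have h1 : L * ((1 - m) * (L + d)) = 0 := by
      linear_combination -hfix' + L * haL + h
    rcases mul_eq_zero.1 h1 with h | h
    · exact hLpos.ne' h
    · rcases mul_eq_zero.1 h with h | h
      · linarith
      · exact hLd h
  have hother : ∀ t ∈ I, b + L * t ≠ 0 := by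
    intro t ht h
    have htL : t ≠ L := by
      rintro rfl
      exact hLb (by linear_combination h)
    have htd := hpole t ht
    have hft : (a * t + b) / (t + d) = t := by
      have h1 := add_mul_moebius htd hfix'
      rw [h, mul_zero, zero_div] at h1
      exact mul_left_cancel₀ hLpos.ne' (by linear_combination h1 - h)
    have h1 := hlt t ht htL
    rw [hft] at h1
    exact lt_irrefl _ h1
  intro t₀ ht₀ ht₀L
  have hw := hother t₀ ht₀
  have hiter : ∀ n : ℕ, (fun t : ℝ => (a * t + b) / (t + d))^[n] t₀ ∈ I ∧
      ((fun t : ℝ => (a * t + b) / (t + d))^[n] t₀ - L) * (b + L * t₀) =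
        m ^ n * (t₀ - L) * (b + L * (fun t : ℝ => (a * t + b) / (t + d))^[n] t₀) := by
    intro n
    induction n with
    | zero => exact ⟨ht₀, by simp⟩
    | succ n ih =>
      rw [Function.iterate_succ_apply']
      obtain ⟨hx, ih⟩ := ih
      refine ⟨hmaps hx, ?_⟩
      generalize (fun t : ℝ => (a * t + b) / (t + d))^[n] t₀ = x at hx ih ⊢
      have hxd := hpole x hx
      rw [moebius_sub_fixed hxd hfix', add_mul_moebius hxd hfix', haL, pow_succ]
      field_simp
      linear_combination ih
  refine ⟨?_, abs_pos.2 (div_ne_zero (mul_ne_zero hLb (sub_ne_zero.2 ht₀L.symm)) hw)⟩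
  have hclosed : ∀ n : ℕ, |L - (fun t : ℝ => (a * t + b) / (t + d))^[n] t₀| / m ^ n =
      |(L ^ 2 + b) * (L - t₀) / (b + L * t₀ - m ^ n * ((t₀ - L) * L))| := by
    intro n
    obtain ⟨-, h⟩ := hiter n
    generalize (fun t : ℝ => (a * t + b) / (t + d))^[n] t₀ = x at h ⊢
    have hmn : 0 < m ^ n := pow_pos hm0 n
    have hD : (x - L) * (b + L * t₀ - m ^ n * ((t₀ - L) * L)) =
        m ^ n * (t₀ - L) * (L ^ 2 + b) := by linear_combination h
    have hD0 : b + L * t₀ - m ^ n * ((t₀ - L) * L) ≠ 0 := by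
      intro h0
      rw [h0, mul_zero] at hD
      exact mul_ne_zero (mul_ne_zero hmn.ne' (sub_ne_zero.2 ht₀L)) hLb hD.symm
    rw [← abs_of_pos hmn, ← abs_div, abs_of_pos hmn]
    congr 1
    rw [div_eq_div_iff hmn.ne' hD0]
    linear_combination -hD
  simp_rw [hclosed]
  have hpow : Tendsto (fun n : ℕ => m ^ n) atTop (𝓝 0) :=
    tendsto_pow_atTop_nhds_zero_of_lt_one hm0.le hm1
  have hden : Tendsto (fun n : ℕ => b + L * t₀ - m ^ n * ((t₀ - L) * L)) atTop
      (𝓝 (b + L * t₀)) := by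
    simpa using (hpow.mul_const ((t₀ - L) * L)).const_sub (b + L * t₀)
  exact (tendsto_const_nhds.div hden hw).abs
end

section
/- Let I be an interval of the reals and let f : I → I be a root-like function: f is twice continuously differentiable, there is a constant k < 1 with 0 < f'(t) ≤ k and f''(t) < 0 for all t ∈ I, and f has a fixed point L > 0 in the interior of I. Set m = f'(L). Then for every t₀ ∈ I with t₀ ≠ L, the candidate sequence c_n = |L − f⁽ⁿ⁾(t₀)| / mⁿ converges to a finite positive limit. -/
open Filter Topology Set

/-- Mean value theorem for `f` between a point and `L`, with unordered endpoints. -/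
theorem exists_mem_uIcc_sub_eq_mul_sub {f f' : ℝ → ℝ} {x L : ℝ}
    (hd : ∀ t ∈ uIcc x L, HasDerivAt f (f' t) t) :
    ∃ ξ ∈ uIcc x L, f x - f L = f' ξ * (x - L) := by
  have hc : ContinuousOn f (uIcc x L) := fun t ht => (hd t ht).continuousAt.continuousWithinAt
  rcases lt_trichotomy x L with h | rfl | h
  · rw [uIcc_of_le h.le] at *
    obtain ⟨ξ, hξ, h'⟩ := exists_hasDerivAt_eq_slope f f' h hc
      fun t ht => hd t (Ioo_subset_Icc_self ht)
    refine ⟨ξ, Ioo_subset_Icc_self hξ, ?_⟩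
    rw [eq_div_iff (sub_pos.2 h).ne'] at h'
    linarith
  · exact ⟨x, left_mem_uIcc, by simp⟩
  · rw [uIcc_of_ge h.le] at *
    obtain ⟨ξ, hξ, h'⟩ := exists_hasDerivAt_eq_slope f f' h hc
      fun t ht => hd t (Ioo_subset_Icc_self ht)
    refine ⟨ξ, Ioo_subset_Icc_self hξ, ?_⟩
    rw [eq_div_iff (sub_pos.2 h).ne'] at h'
    linarith

/-- The logarithm of a positive continuously differentiable function is Lipschitz on a compact
interval. -/
theorem exists_abs_log_sub_log_le {g g' : ℝ → ℝ} {a b : ℝ}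
    (hd : ∀ t ∈ uIcc a b, HasDerivAt g (g' t) t) (hcont : ContinuousOn g' (uIcc a b))
    (hpos : ∀ t ∈ uIcc a b, 0 < g t) :
    ∃ C, 0 ≤ C ∧ ∀ x ∈ uIcc a b, ∀ y ∈ uIcc a b,
      |Real.log (g y) - Real.log (g x)| ≤ C * |y - x| := by
  have hc : ContinuousOn g (uIcc a b) := fun t ht => (hd t ht).continuousAt.continuousWithinAt
  obtain ⟨C, hC⟩ := isCompact_uIcc.exists_bound_of_continuousOn
    (hcont.div hc fun t ht => (hpos t ht).ne')
  refine ⟨C, (norm_nonneg _).trans (hC a left_mem_uIcc), fun x hx y hy => ?_⟩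
  exact (convex_uIcc a b).norm_image_sub_le_of_norm_hasDerivWithin_le
    (fun t ht => ((hd t ht).log (hpos t ht).ne').hasDerivWithinAt) hC hx hy

/-- Candidate sequences for root-like functions converge properly. -/
theorem stmt7 (I : Set ℝ) (hI : Convex ℝ I) (f f' f'' : ℝ → ℝ)
    (hmaps : Set.MapsTo f I I)
    (hd1 : ∀ t ∈ I, HasDerivAt f (f' t) t)
    (hd2 : ∀ t ∈ I, HasDerivAt f' (f'' t) t)
    (hcont : ContinuousOn f'' I)
    (k : ℝ) (hk : k < 1)
    (hf' : ∀ t ∈ I, 0 < f' t ∧ f' t ≤ k)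
    (hf'' : ∀ t ∈ I, f'' t < 0)
    (L : ℝ) (hL : L ∈ interior I) (hLpos : 0 < L) (hfix : f L = L)
    (m : ℝ) (hm : m = f' L) :
    ∀ t₀ ∈ I, t₀ ≠ L →
      ∃ M > 0, Tendsto (fun n : ℕ => |L - f^[n] t₀| / m ^ n) atTop (𝓝 M) := by
  intro t₀ ht₀ hne
  subst hm
  have hLI : L ∈ I := interior_subset hL
  have hJI : uIcc t₀ L ⊆ I := by
    rw [← segment_eq_uIcc]
    exact hI.segment_subset ht₀ hLI
  have hk0 : 0 < k := (hf' L hLI).1.trans_le (hf' L hLI).2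
  have hm0 : 0 < f' L := (hf' L hLI).1
  obtain ⟨C, hC0, hC⟩ := exists_abs_log_sub_log_le (fun t ht => hd2 t (hJI ht))
    (hcont.mono hJI) (fun t ht => (hf' t (hJI ht)).1)
  have step : ∀ x ∈ uIcc t₀ L, ∃ ξ ∈ uIcc t₀ L, |ξ - L| ≤ |x - L| ∧
      f x - L = f' ξ * (x - L) := by
    intro x hx
    have hsub : uIcc x L ⊆ uIcc t₀ L := uIcc_subset_uIcc hx right_mem_uIcc
    obtain ⟨ξ, hξ, h⟩ := exists_mem_uIcc_sub_eq_mul_sub fun t ht => hd1 t (hJI (hsub ht))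
    refine ⟨ξ, hsub hξ, ?_, by rwa [hfix] at h⟩
    rw [abs_sub_comm ξ, abs_sub_comm x]
    exact abs_sub_right_of_mem_uIcc hξ
  have orbit : ∀ n : ℕ, f^[n] t₀ ∈ uIcc t₀ L ∧ f^[n] t₀ ≠ L ∧
      |f^[n] t₀ - L| ≤ k ^ n * |t₀ - L| := by
    intro n
    induction n with
    | zero => simp [hne]
    | succ n ih =>
      obtain ⟨hx, hxL, hle⟩ := ih
      obtain ⟨ξ, hξ, -, h⟩ := step _ hx
      obtain ⟨hpos, hlek⟩ := hf' ξ (hJI hξ)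
      rw [Function.iterate_succ_apply']
      refine ⟨?_, ?_, ?_⟩
      · have := (convex_uIcc t₀ L).add_smul_sub_mem right_mem_uIcc hx
          (t := f' ξ) ⟨hpos.le, hlek.trans hk.le⟩
        rwa [smul_eq_mul, ← h, add_sub_cancel] at this
      · rw [← sub_ne_zero, h]
        exact mul_ne_zero hpos.ne' (sub_ne_zero.2 hxL)
      · rw [h, abs_mul, abs_of_pos hpos, pow_succ', mul_assoc]
        exact mul_le_mul hlek hle (abs_nonneg _) hk0.le
  have hcpos : ∀ n : ℕ, 0 < |L - f^[n] t₀| / f' L ^ n := fun n =>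
    div_pos (abs_pos.2 (sub_ne_zero.2 (orbit n).2.1.symm)) (pow_pos hm0 n)
  have hcauchy : CauchySeq fun n : ℕ => Real.log (|L - f^[n] t₀| / f' L ^ n) := by
    refine cauchySeq_of_le_geometric k (C * |t₀ - L|) hk fun n => ?_
    obtain ⟨hx, hxL, hle⟩ := orbit n
    obtain ⟨ξ, hξ, hξle, h⟩ := step _ hx
    have hpos := (hf' ξ (hJI hξ)).1
    have hsucc : |L - f^[n + 1] t₀| / f' L ^ (n + 1) =
        f' ξ / f' L * (|L - f^[n] t₀| / f' L ^ n) := by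
      rw [Function.iterate_succ_apply', abs_sub_comm, h, abs_mul, abs_of_pos hpos,
        abs_sub_comm _ L, pow_succ', mul_div_mul_comm]
    rw [dist_comm, Real.dist_eq, hsucc, Real.log_mul (div_pos hpos hm0).ne' (hcpos n).ne',
      add_sub_cancel_right, Real.log_div hpos.ne' hm0.ne']
    calc |Real.log (f' ξ) - Real.log (f' L)| ≤ C * |ξ - L| := hC L right_mem_uIcc ξ hξ
      _ ≤ C * (k ^ n * |t₀ - L|) := mul_le_mul_of_nonneg_left (hξle.trans hle) hC0
      _ = C * |t₀ - L| * k ^ n := by ring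
  obtain ⟨S, hS⟩ := cauchySeq_tendsto_of_complete hcauchy
  refine ⟨Real.exp S, Real.exp_pos S, ?_⟩
  refine ((Real.continuous_exp.tendsto S).comp hS).congr fun n => ?_
  exact Real.exp_log (hcpos n)
end

section
/- Let f(t) = √(2 + t) and let f⁽ⁿ⁾(0) denote the n-th iterate of f applied to 0 (so f⁽ⁿ⁾(0) is the nested radical √(2 + √(2 + ⋯ + √2)) with n radicals). Then the sequence 4ⁿ · (2 − f⁽ⁿ⁾(0)) converges to π²/4; equivalently, the sequence 2ⁿ · √(2 − √(2 + √(2 + ⋯ + √2))) (with n nested radicals in total) converges to π. -/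
open Filter Topology Real

theorem iterate_sqrt_two_add_eq_sqrtTwoAddSeries (x : ℝ) (n : ℕ) :
    (fun t : ℝ => Real.sqrt (2 + t))^[n] x = sqrtTwoAddSeries x n := by
  induction n with
  | zero => rfl
  | succ n ih => rw [Function.iterate_succ_apply', ih, sqrtTwoAddSeries]

theorem tendsto_two_pow_mul_sqrt_two_sub_sqrtTwoAddSeries :
    Tendsto (fun n : ℕ => (2 : ℝ) ^ (n + 1) * Real.sqrt (2 - sqrtTwoAddSeries 0 n)) atTop
      (𝓝 π) := by
  have h : Tendsto (fun n : ℕ => π - 1 / (4 : ℝ) ^ n) atTop (𝓝 π) := by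
    simpa using (tendsto_pow_atTop_nhds_zero_of_lt_one (r := (4 : ℝ)⁻¹)
      (by norm_num) (by norm_num)).const_sub π
  refine tendsto_of_tendsto_of_tendsto_of_le_of_le h tendsto_const_nhds (fun n => ?_)
    (fun n => (pi_gt_sqrtTwoAddSeries n).le)
  linarith [pi_lt_sqrtTwoAddSeries n]

/-- Currie's mysterious pattern: `4^n (2 - f^[n] 0) → π²/4`, equivalently
`2^n √(2 - √(2 + ⋯ + √2)) → π` (with `n` nested radicals in total). -/
theorem stmt8 (f : ℝ → ℝ) (hf : f = fun t => Real.sqrt (2 + t)) :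
    Tendsto (fun n : ℕ => (4 : ℝ) ^ n * (2 - f^[n] 0)) atTop (𝓝 (π ^ 2 / 4)) ∧
    Tendsto (fun n : ℕ => (2 : ℝ) ^ (n + 1) * Real.sqrt (2 - f^[n] 0)) atTop
      (𝓝 π) := by
  subst hf
  simp only [iterate_sqrt_two_add_eq_sqrtTwoAddSeries]
  have h := tendsto_two_pow_mul_sqrt_two_sub_sqrtTwoAddSeries
  refine ⟨((h.pow 2).div_const 4).congr fun n => ?_, h⟩
  rw [mul_pow, Real.sq_sqrt (sub_nonneg.2 (sqrtTwoAddSeries_lt_two n).le), ← pow_mul,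
    mul_comm (n + 1) 2, pow_mul, pow_succ]
  norm_num
  ring
end

section
/- Let I be a closed interval of the reals, f : I → I continuously differentiable with |f'(t)| ≤ k < 1 on I, with fixed point L in the interior of I, and set m = |f'(L)| > 0. Let t₀ ∈ I with t₀ ≠ L and suppose f⁽ⁿ⁾(t₀) ≠ L for all n. Let r > 0. If r < m then the sequence |L − f⁽ⁿ⁾(t₀)| / rⁿ tends to infinity, and if r > m then it tends to 0. In particular, |L − f⁽ⁿ⁾(t₀)| / rⁿ can converge to a finite positive limit only when r = m. -/
open Filter Topology Set

theorem tendsto_zero_of_ratio_tendsto_lt_one {a : ℕ → ℝ} {l : ℝ} (ha : ∀ n, 0 < a n)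
    (hl : l < 1) (h : Tendsto (fun n => a (n + 1) / a n) atTop (𝓝 l)) :
    Tendsto a atTop (𝓝 0) := by
  refine (summable_of_ratio_test_tendsto_lt_one hl
    (Eventually.of_forall fun n => (ha n).ne') ?_).tendsto_atTop_zero
  simpa only [Real.norm_of_nonneg (ha _).le] using h

theorem tendsto_atTop_of_one_lt_ratio_tendsto {a : ℕ → ℝ} {l : ℝ} (ha : ∀ n, 0 < a n)
    (hl : 1 < l) (h : Tendsto (fun n => a (n + 1) / a n) atTop (𝓝 l)) :
    Tendsto a atTop atTop := by
  have hinv : Tendsto (fun n => (a n)⁻¹) atTop (𝓝 0) := by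
    refine tendsto_zero_of_ratio_tendsto_lt_one (fun n => inv_pos.2 (ha n))
      (inv_lt_one_of_one_lt₀ hl) ((h.inv₀ (by positivity)).congr fun n => ?_)
    rw [inv_div_inv, inv_div]
  have hpos : Tendsto (fun n => (a n)⁻¹) atTop (𝓝[>] 0) :=
    tendsto_nhdsWithin_iff.2 ⟨hinv, Eventually.of_forall fun n => inv_pos.2 (ha n)⟩
  exact hpos.inv_tendsto_nhdsGT_zero.congr fun n => inv_inv (a n)

theorem tendsto_iterate_of_abs_deriv_le {I : Set ℝ} (hI : Convex ℝ I) {f f' : ℝ → ℝ}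
    (hmaps : MapsTo f I I) (hd : ∀ t ∈ I, HasDerivAt f (f' t) t) {k : ℝ} (hk : k < 1)
    (hbound : ∀ t ∈ I, |f' t| ≤ k) {L : ℝ} (hL : L ∈ I) (hfix : f L = L)
    {t : ℝ} (ht : t ∈ I) : Tendsto (fun n => f^[n] t) atTop (𝓝 L) := by
  have hk0 : 0 ≤ k := (abs_nonneg _).trans (hbound L hL)
  have hle : ∀ n, ‖f^[n] t - L‖ ≤ k ^ n * ‖t - L‖ := by
    intro n
    induction n with
    | zero => simp
    | succ n ih =>
      have hstep := hI.norm_image_sub_le_of_norm_hasDerivWithin_le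
        (fun x hx => (hd x hx).hasDerivWithinAt) hbound hL (hmaps.iterate n ht)
      rw [hfix] at hstep
      rw [Function.iterate_succ_apply', pow_succ', mul_assoc]
      exact hstep.trans (by gcongr)
  rw [tendsto_iff_norm_sub_tendsto_zero]
  refine squeeze_zero (fun n => norm_nonneg _) hle ?_
  simpa using (tendsto_pow_atTop_nhds_zero_of_lt_one hk0 hk).mul_const ‖t - L‖

theorem tendsto_abs_sub_iterate_ratio {f : ℝ → ℝ} {d L t : ℝ} (hd : HasDerivAt f d L)
    (hfix : f L = L) (hne : ∀ n : ℕ, f^[n] t ≠ L)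
    (ht : Tendsto (fun n => f^[n] t) atTop (𝓝 L)) :
    Tendsto (fun n => |L - f^[n + 1] t| / |L - f^[n] t|) atTop (𝓝 |d|) := by
  have hslope := (hasDerivAt_iff_tendsto_slope.1 hd).comp
    (tendsto_nhdsWithin_iff.2 ⟨ht, Eventually.of_forall hne⟩)
  refine hslope.abs.congr fun n => ?_
  rw [Function.comp_apply, slope_def_field, hfix, abs_div, Function.iterate_succ_apply',
    abs_sub_comm L, abs_sub_comm L]

/-- The scaling factor `r` of a properly convergent candidate sequence must
equal `m = |f'(L)|`: for `r < m` the scaled sequence blows up, for `r > m` it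
tends to `0`. -/
theorem stmt9 (I : Set ℝ) (hI : Convex ℝ I) (hIc : IsClosed I)
    (f f' : ℝ → ℝ) (hmaps : Set.MapsTo f I I)
    (hd : ∀ t ∈ I, HasDerivAt f (f' t) t)
    (hcont : ContinuousOn f' I)
    (k : ℝ) (hk : k < 1) (hbound : ∀ t ∈ I, |f' t| ≤ k)
    (L : ℝ) (hL : L ∈ interior I) (hfix : f L = L)
    (m : ℝ) (hm : m = |f' L|) (hm0 : 0 < m)
    (t₀ : ℝ) (ht₀ : t₀ ∈ I) (hne : t₀ ≠ L)
    (horbit : ∀ n : ℕ, f^[n] t₀ ≠ L)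
    (r : ℝ) (hr : 0 < r) :
    (r < m → Tendsto (fun n : ℕ => |L - f^[n] t₀| / r ^ n) atTop atTop) ∧
    (m < r → Tendsto (fun n : ℕ => |L - f^[n] t₀| / r ^ n) atTop (𝓝 0)) := by
  have hLI : L ∈ I := interior_subset hL
  have hratio := tendsto_abs_sub_iterate_ratio (hd L hLI) hfix horbit
    (tendsto_iterate_of_abs_deriv_le hI hmaps hd hk hbound hLI hfix ht₀)
  rw [← hm] at hratio
  have hpos : ∀ n : ℕ, 0 < |L - f^[n] t₀| / r ^ n := fun n =>
    div_pos (abs_pos.2 (sub_ne_zero.2 (horbit n).symm)) (pow_pos hr n)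
  have hscaled : Tendsto (fun n : ℕ => (|L - f^[n + 1] t₀| / r ^ (n + 1)) /
      (|L - f^[n] t₀| / r ^ n)) atTop (𝓝 (m / r)) := by
    refine (hratio.div_const r).congr fun n => ?_
    rw [div_div_div_comm, pow_succ', mul_div_cancel_right₀ _ (pow_pos hr n).ne']
  exact ⟨fun h => tendsto_atTop_of_one_lt_ratio_tendsto hpos ((one_lt_div hr).2 h) hscaled,
    fun h => tendsto_zero_of_ratio_tendsto_lt_one hpos ((div_lt_one hr).2 h) hscaled⟩
end

section
/- Let f(t) = 2 + 15/t, which has attracting fixed point L = 5 with f'(5) = −3/5. For every t₀ > 0, the sequence (5/3)ⁿ · |5 − f⁽ⁿ⁾(t₀)| converges to |8(5 − t₀)/(3 + t₀)|. In particular, with t₀ = 2 (corresponding to the finite continued fraction 2 + 15/(2 + 15/(2 + ⋯ + 15/2))), the limit equals 24/5. -/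
open Filter Topology

theorem iterate_two_add_fifteen_div_pos {t : ℝ} (ht : 0 < t) (n : ℕ) :
    0 < (fun x : ℝ => 2 + 15 / x)^[n] t := by
  induction n with
  | zero => exact ht
  | succ n ih =>
    rw [Function.iterate_succ_apply']
    positivity

/-- The coordinate `(5 - t) / (3 + t)` linearizes `t ↦ 2 + 15 / t`, with multiplier `-3/5`. -/
theorem linearization_iterate_two_add_fifteen_div {t : ℝ} (ht : 0 < t) (n : ℕ) :
    (5 - (fun x : ℝ => 2 + 15 / x)^[n] t) / (3 + (fun x : ℝ => 2 + 15 / x)^[n] t) =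
      (-3 / 5) ^ n * ((5 - t) / (3 + t)) := by
  induction n with
  | zero => simp
  | succ n ih =>
    have hpos := iterate_two_add_fifteen_div_pos ht n
    rw [Function.iterate_succ_apply', pow_succ', mul_assoc, ← ih]
    generalize (fun x : ℝ => 2 + 15 / x)^[n] t = s at hpos
    have h₁ : 3 + (2 + 15 / s) ≠ 0 := by positivity
    have h₂ : 3 + s ≠ 0 := by positivity
    rw [div_eq_iff h₁]
    field_simp
    ring

theorem pow_mul_abs_five_sub_iterate {t : ℝ} (ht : 0 < t) (n : ℕ) :
    (5 / 3 : ℝ) ^ n * |5 - (fun x : ℝ => 2 + 15 / x)^[n] t| =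
      |(5 - t) / (3 + t)| * (8 / (1 + (-3 / 5) ^ n * ((5 - t) / (3 + t)))) := by
  have hpos := iterate_two_add_fifteen_div_pos ht n
  have hlin := linearization_iterate_two_add_fifteen_div ht n
  generalize (fun x : ℝ => 2 + 15 / x)^[n] t = s at hpos hlin ⊢
  generalize (5 - t) / (3 + t) = w at hlin ⊢
  have h₃ : 0 < 3 + s := by positivity
  have hs : 8 / (1 + (-3 / 5) ^ n * w) = 3 + s := by
    rw [← hlin, one_add_div h₃.ne']
    field_simp
    ring
  have hpow : (5 / 3 : ℝ) ^ n * (3 / 5) ^ n = 1 := by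
    rw [← mul_pow]
    norm_num
  have habs : |5 - s| = (3 / 5) ^ n * |w| * (3 + s) := by
    rw [(div_eq_iff h₃.ne').mp hlin, abs_mul, abs_mul, abs_pow, abs_of_pos h₃]
    norm_num [abs_div]
  rw [hs, habs]
  linear_combination |w| * (3 + s) * hpow

theorem tendsto_pow_mul_abs_five_sub_iterate {t : ℝ} (ht : 0 < t) :
    Tendsto (fun n : ℕ => (5 / 3 : ℝ) ^ n * |5 - (fun x : ℝ => 2 + 15 / x)^[n] t|) atTop
      (𝓝 |8 * (5 - t) / (3 + t)|) := by
  simp_rw [pow_mul_abs_five_sub_iterate ht]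
  have hpow : Tendsto (fun n : ℕ => (-3 / 5 : ℝ) ^ n) atTop (𝓝 0) :=
    tendsto_pow_atTop_nhds_zero_of_abs_lt_one (by norm_num [abs_div])
  have hden := (hpow.mul_const ((5 - t) / (3 + t))).const_add 1
  have hlim : |8 * (5 - t) / (3 + t)| =
      |(5 - t) / (3 + t)| * (8 / (1 + 0 * ((5 - t) / (3 + t)))) := by
    rw [mul_div_assoc, abs_mul]
    norm_num [mul_comm]
  rw [hlim]
  exact (tendsto_const_nhds.div hden (by simp)).const_mul _

/-- Candidate sequence limits for the continued-fraction map `f(t) = 2 + 15/t`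
with attracting fixed point `5`; in particular the limit is `24/5` for
`t₀ = 2`. -/
theorem stmt11 (f : ℝ → ℝ) (hf : f = fun t => 2 + 15 / t) :
    (∀ t₀ : ℝ, 0 < t₀ →
      Tendsto (fun n : ℕ => (5 / 3 : ℝ) ^ n * |5 - f^[n] t₀|) atTop
        (𝓝 |8 * (5 - t₀) / (3 + t₀)|)) ∧
    Tendsto (fun n : ℕ => (5 / 3 : ℝ) ^ n * |5 - f^[n] 2|) atTop
      (𝓝 (24 / 5)) := by
  subst hf
  refine ⟨fun t₀ ht₀ => tendsto_pow_mul_abs_five_sub_iterate ht₀, ?_⟩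
  have h := tendsto_pow_mul_abs_five_sub_iterate (t := 2) two_pos
  have hlim : |8 * (5 - 2) / (3 + 2)| = (24 / 5 : ℝ) := by norm_num [abs_div]
  rwa [hlim] at h
end

section
/- Let 0 < α < 1, let φ : ℝ → ℝ be differentiable at 0 with φ(0) = L and φ'(0) ≠ 0, and let f be a function satisfying f(φ(θ)) = φ(α·θ) for all θ. Then for every real θ₀, the iterates satisfy f⁽ⁿ⁾(φ(θ₀)) = φ(αⁿ·θ₀), and the candidate sequence |L − f⁽ⁿ⁾(t₀)| / αⁿ with t₀ = φ(θ₀) converges to |θ₀ · φ'(0)|. -/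
open Filter Topology

/-- Candidate sequence limits via an eigen-function `φ` with `φ'(0) ≠ 0`. -/
theorem stmt12 (α : ℝ) (hα0 : 0 < α) (hα1 : α < 1)
    (φ : ℝ → ℝ) (L p : ℝ) (hφ0 : φ 0 = L)
    (hd : HasDerivAt φ p 0) (hp : p ≠ 0)
    (f : ℝ → ℝ) (hconj : ∀ θ : ℝ, f (φ θ) = φ (α * θ)) :
    ∀ θ₀ : ℝ,
      (∀ n : ℕ, f^[n] (φ θ₀) = φ (α ^ n * θ₀)) ∧
      Tendsto (fun n : ℕ => |L - f^[n] (φ θ₀)| / α ^ n) atTop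
        (𝓝 |θ₀ * p|) := by
  intro θ₀
  have hiter (n : ℕ) : f^[n] (φ θ₀) = φ (α ^ n * θ₀) := by
    have hsemi : Function.Semiconj φ (α * ·) f := fun θ => (hconj θ).symm
    simpa only [mul_left_iterate] using (hsemi.iterate_right n θ₀).symm
  refine ⟨hiter, ?_⟩
  have hpow : Tendsto (fun n : ℕ => α ^ n) atTop (𝓝[≠] 0) :=
    tendsto_nhdsWithin_iff.2 ⟨tendsto_pow_atTop_nhds_zero_of_lt_one hα0.le hα1,
      Eventually.of_forall fun n => (pow_pos hα0 n).ne'⟩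
  have hscaled : HasDerivAt (fun t => φ (t * θ₀)) (p * θ₀) 0 := by
    have hmul : HasDerivAt (fun t : ℝ => t * θ₀) θ₀ 0 := hasDerivAt_mul_const θ₀
    exact HasDerivAt.comp (0 : ℝ) (by simpa using hd) hmul
  have hlim := (hscaled.tendsto_slope_zero.comp hpow).abs
  rw [mul_comm θ₀ p]
  refine hlim.congr fun n => ?_
  simp only [Function.comp_apply, zero_add, zero_mul, hφ0, smul_eq_mul]
  rw [hiter, abs_mul, abs_inv, abs_of_pos (pow_pos hα0 n), abs_sub_comm, div_eq_inv_mul]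
end

section
/- Let 0 < α < 1, let φ : ℝ → ℝ be twice differentiable at 0 with φ(0) = L, φ'(0) = 0 and φ''(0) ≠ 0, and let f satisfy f(φ(θ)) = φ(α·θ) for all θ. Then for every real θ₀ ≠ 0, the candidate sequence |L − f⁽ⁿ⁾(t₀)| / (α²)ⁿ with t₀ = φ(θ₀) converges to |θ₀² · φ''(0) / 2|. -/
open Filter Topology

/-- Second-order Peano expansion at `0` of a function with vanishing derivative there. -/
theorem tendsto_sub_div_sq_of_hasDerivAt {φ φ' : ℝ → ℝ} {s : ℝ}
    (hd1 : ∀ᶠ θ in 𝓝 (0 : ℝ), HasDerivAt φ (φ' θ) θ)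
    (hd2 : HasDerivAt φ' s 0) (hφ'0 : φ' 0 = 0) :
    Tendsto (fun θ => (φ θ - φ 0) / θ ^ 2) (𝓝[≠] 0) (𝓝 (s / 2)) := by
  have hcont : ContinuousAt φ 0 := hd1.self_of_nhds.continuousAt
  refine HasDerivAt.lhopital_zero_nhdsNE (f' := φ') (g' := fun θ => 2 * θ) ?_ ?_ ?_ ?_ ?_ ?_
  · filter_upwards [hd1.filter_mono nhdsWithin_le_nhds] with θ hθ
    exact hθ.sub_const _
  · filter_upwards with θ
    simpa using hasDerivAt_pow 2 θ
  · filter_upwards [self_mem_nhdsWithin] with θ hθ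
    exact mul_ne_zero two_ne_zero hθ
  · have h := hcont.tendsto.sub_const (φ 0)
    rw [sub_self] at h
    exact h.mono_left nhdsWithin_le_nhds
  · have h : Tendsto (fun θ : ℝ => θ ^ 2) (𝓝 0) (𝓝 (0 ^ 2)) := (continuous_pow 2).tendsto 0
    rw [zero_pow two_ne_zero] at h
    exact h.mono_left nhdsWithin_le_nhds
  · refine ((hasDerivAt_iff_tendsto_slope.mp hd2).div_const 2).congr fun θ => ?_
    rw [slope_def_field, hφ'0, sub_zero, sub_zero, div_div, mul_comm]

/-- Candidate sequence limits via an eigen-function `φ` with `φ'(0) = 0` and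
`φ''(0) ≠ 0`; the scaling factor is `α²`. -/
theorem stmt13 (α : ℝ) (hα0 : 0 < α) (hα1 : α < 1)
    (φ φ' : ℝ → ℝ) (L s : ℝ) (hφ0 : φ 0 = L)
    (hd1 : ∀ᶠ θ in 𝓝 (0 : ℝ), HasDerivAt φ (φ' θ) θ)
    (hd2 : HasDerivAt φ' s 0)
    (hφ'0 : φ' 0 = 0) (hs : s ≠ 0)
    (f : ℝ → ℝ) (hconj : ∀ θ : ℝ, f (φ θ) = φ (α * θ)) :
    ∀ θ₀ : ℝ, θ₀ ≠ 0 →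
      Tendsto (fun n : ℕ => |L - f^[n] (φ θ₀)| / (α ^ 2) ^ n) atTop
        (𝓝 |θ₀ ^ 2 * s / 2|) := by
  intro θ₀ hθ₀
  subst hφ0
  have hiter (n : ℕ) : f^[n] (φ θ₀) = φ (α ^ n * θ₀) := by
    have h : Function.Semiconj φ (α * ·) f := fun θ => (hconj θ).symm
    rw [← (h.iterate_right n).eq, mul_left_iterate]
  have hne (n : ℕ) : α ^ n * θ₀ ≠ 0 := mul_ne_zero (pow_ne_zero n hα0.ne') hθ₀
  have hlim : Tendsto (fun n : ℕ => α ^ n * θ₀) atTop (𝓝[≠] 0) := by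
    refine tendsto_nhdsWithin_iff.mpr ⟨?_, Eventually.of_forall hne⟩
    simpa using (tendsto_pow_atTop_nhds_zero_of_lt_one hα0.le hα1).mul_const θ₀
  have key := (((tendsto_sub_div_sq_of_hasDerivAt hd1 hd2 hφ'0).comp hlim).const_mul (θ₀ ^ 2)).abs
  rw [← mul_div_assoc] at key
  refine key.congr fun n => ?_
  have hpos : 0 < (α ^ 2) ^ n := by positivity
  rw [hiter, abs_sub_comm (φ 0), ← abs_of_pos hpos, ← abs_div, Function.comp_apply]
  congr 1
  rw [pow_right_comm α 2 n]
  field_simp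
end

section
/- Let 0 < α < 1, let φ : ℝ → ℝ be twice differentiable at 0 with φ'(0) = 0 and φ''(0) ≠ 0, and let f be differentiable at L = φ(0) and satisfy f(φ(θ)) = φ(α·θ) for all θ in a neighborhood of 0. Then f'(L) = α². -/
open Filter Topology

/-- If `φ` is an eigen-function for `f` with `φ'(0) = 0` and `φ''(0) ≠ 0`,
then `f'(L) = α²` at the fixed point `L = φ(0)`. -/
theorem stmt14 (α : ℝ) (hα0 : 0 < α) (hα1 : α < 1)
    (φ φ' : ℝ → ℝ) (L s : ℝ) (hφ0 : φ 0 = L)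
    (hd1 : ∀ᶠ θ in 𝓝 (0 : ℝ), HasDerivAt φ (φ' θ) θ)
    (hd2 : HasDerivAt φ' s 0)
    (hφ'0 : φ' 0 = 0) (hs : s ≠ 0)
    (f : ℝ → ℝ) (hdf : DifferentiableAt ℝ f L)
    (hconj : ∀ᶠ θ in 𝓝 (0 : ℝ), f (φ θ) = φ (α * θ)) :
    deriv f L = α ^ 2 := by
  subst hφ0
  have hfix : f (φ 0) = φ 0 := by simpa using hconj.self_of_nhds
  have hT := tendsto_sub_div_sq_of_hasDerivAt hd1 hd2 hφ'0
  have hscale : Tendsto (fun θ : ℝ => α * θ) (𝓝[≠] 0) (𝓝[≠] 0) := by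
    refine tendsto_nhdsWithin_iff.mpr ⟨?_, ?_⟩
    · have h : Tendsto (fun θ : ℝ => α * θ) (𝓝 0) (𝓝 (α * 0)) :=
        (continuous_const_mul α).tendsto 0
      rw [mul_zero] at h
      exact h.mono_left nhdsWithin_le_nhds
    · filter_upwards [self_mem_nhdsWithin] with θ hθ
      exact mul_ne_zero hα0.ne' hθ
  have hslope : Tendsto (fun θ => dslope f (φ 0) (φ θ)) (𝓝[≠] 0) (𝓝 (deriv f (φ 0))) := by
    have h : Tendsto (dslope f (φ 0)) (𝓝 (φ 0)) (𝓝 (dslope f (φ 0) (φ 0))) :=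
      continuousAt_dslope_same.mpr hdf
    rw [dslope_same] at h
    exact h.comp (hd1.self_of_nhds.continuousAt.tendsto.mono_left nhdsWithin_le_nhds)
  have hleft := hslope.mul hT
  have hright := (hT.comp hscale).const_mul (α ^ 2)
  have heq := tendsto_nhds_unique_of_eventuallyEq hleft hright (by
    filter_upwards [hconj.filter_mono nhdsWithin_le_nhds, self_mem_nhdsWithin] with θ hθ hne
    have hne : θ ≠ 0 := hne
    have h := sub_smul_dslope f (φ 0) (φ θ)
    rw [hfix, hθ, smul_eq_mul] at h
    simp only [Function.comp_apply, ← h]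
    field_simp [hα0.ne'])
  exact mul_right_cancel₀ (div_ne_zero hs two_ne_zero) heq
end

section
/- Let (a_n) be the sequence of reals defined by a₀ = 3, a₁ = 1, and for n ≥ 2, a_n = (∑_{k=1}^{n−1} C(n,k) · a_k · a_{n−k}) / (6ⁿ − 6), where C(n,k) is the binomial coefficient. Then 0 ≤ a_n ≤ 1 for all n ≥ 1. -/
open Filter Topology Finset

/-- The Taylor coefficients (derivatives at 0) of the constructed
eigen-function for `f(t) = √(6 + t)` all lie in `[0, 1]` from index 1 on. -/
theorem stmt15 (a : ℕ → ℝ) (h0 : a 0 = 3) (h1 : a 1 = 1)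
    (hrec : ∀ n : ℕ, 2 ≤ n →
      a n = (∑ k ∈ Finset.Ico 1 n, (n.choose k : ℝ) * a k * a (n - k)) /
        (6 ^ n - 6)) :
    ∀ n : ℕ, 1 ≤ n → 0 ≤ a n ∧ a n ≤ 1 := by
  intro n
  induction n using Nat.strong_induction_on with
  | _ n ih =>
    intro hn
    obtain rfl | hn2 : n = 1 ∨ 2 ≤ n := by omega
    · norm_num [h1]
    have hbound : ∀ k ∈ Finset.Ico 1 n,
        0 ≤ (n.choose k : ℝ) * a k * a (n - k) ∧
          (n.choose k : ℝ) * a k * a (n - k) ≤ n.choose k := by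
      intro k hk
      rw [Finset.mem_Ico] at hk
      obtain ⟨hk0, hk1⟩ := ih k hk.2 hk.1
      obtain ⟨hl0, hl1⟩ := ih (n - k) (by omega) (by omega)
      refine ⟨by positivity, ?_⟩
      rw [mul_assoc]
      exact mul_le_of_le_one_right (by positivity) (mul_le_one₀ hk1 hl0 hl1)
    have hchoose : ∑ k ∈ Finset.Ico 1 n, (n.choose k : ℝ) ≤ 2 ^ n := by
      have hsub : Finset.Ico 1 n ⊆ Finset.range (n + 1) := fun k hk => by
        simp only [Finset.mem_Ico, Finset.mem_range] at hk ⊢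
        omega
      exact_mod_cast (Finset.sum_le_sum_of_subset hsub).trans_eq (Nat.sum_range_choose n)
    have hpow : (2 : ℝ) ^ n ≤ 6 ^ n - 6 := by
      have h3 : (3 : ℝ) ^ 2 ≤ 3 ^ n := pow_le_pow_right₀ (by norm_num) hn2
      have h2 : (1 : ℝ) ≤ 2 ^ n := one_le_pow₀ (by norm_num)
      have h6 : (6 : ℝ) ^ n = 3 ^ n * 2 ^ n := by rw [← mul_pow]; norm_num
      nlinarith
    have hpos : (0 : ℝ) < 6 ^ n - 6 := lt_of_lt_of_le (by positivity) hpow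
    rw [hrec n hn2]
    refine ⟨div_nonneg (Finset.sum_nonneg fun k hk => (hbound k hk).1) hpos.le, ?_⟩
    rw [div_le_one hpos]
    exact ((Finset.sum_le_sum fun k hk => (hbound k hk).2).trans hchoose).trans hpow
end

section
/- Let L > 1 be a real number and define f_L(t) = √(L² − L + t) for t ≥ L − L². Then the sequence (2L)ⁿ · (L − f_L⁽ⁿ⁻¹⁾(0)) (for n ≥ 1) converges to a finite positive limit; consequently C(L) = √(lim_{n→∞} (2L)ⁿ (L − f_L⁽ⁿ⁻¹⁾(0))) is well defined for all L > 1. -/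
open Filter Topology

/-- One step of `t ↦ √(L² - L + t)` maps `[0, L]` to itself, and the distances to the fixed
point `L` before and after the step differ by the factor `L + √(L² - L + t)`. -/
theorem sqrt_step {L t : ℝ} (hL : 1 < L) (h0 : 0 ≤ t) (h1 : t ≤ L) :
    0 ≤ Real.sqrt (L ^ 2 - L + t) ∧ Real.sqrt (L ^ 2 - L + t) ≤ L ∧
      L - t = (L - Real.sqrt (L ^ 2 - L + t)) * (L + Real.sqrt (L ^ 2 - L + t)) := by
  have hsq : Real.sqrt (L ^ 2 - L + t) ^ 2 = L ^ 2 - L + t := Real.sq_sqrt (by nlinarith)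
  refine ⟨Real.sqrt_nonneg _, Real.sqrt_le_iff.2 ⟨by linarith, by linarith⟩, ?_⟩
  linear_combination hsq

/-- The exponential weight absorbs the growth of the rescaled distance to `L` in one step,
where `y` is the image of a point at distance `(L - y) * (L + y)` from `L`. -/
theorem two_mul_mul_exp_le {L y : ℝ} (hL : 1 < L) (h0 : 0 ≤ y) (h1 : y ≤ L) :
    2 * L * Real.exp ((L - y) / (L * (L - 1))) ≤
      (L + y) * Real.exp ((L - y) * (L + y) / (L * (L - 1))) := by
  have hL0 : 0 < L := by linarith
  have hL1 : 0 < L - 1 := by linarith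
  have hsplit : (L - y) / (L * (L - 1)) + (L - y) / L ≤ (L - y) * (L + y) / (L * (L - 1)) := by
    have : (L - y) * (L + y) / (L * (L - 1)) - ((L - y) / (L * (L - 1)) + (L - y) / L)
        = (L - y) * y / (L * (L - 1)) := by
      field_simp
      ring
    have : 0 ≤ (L - y) * y / (L * (L - 1)) :=
      div_nonneg (mul_nonneg (by linarith) h0) (by positivity)
    linarith
  have hratio : 2 * L ≤ (L + y) * Real.exp ((L - y) / L) := by
    have hmul : (L + y) * ((L - y) / L + 1) = 2 * L + (L - y) * y / L := by
      field_simp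
      ring
    have : 0 ≤ (L - y) * y / L := div_nonneg (mul_nonneg (by linarith) h0) hL0.le
    calc 2 * L ≤ (L + y) * ((L - y) / L + 1) := by linarith
      _ ≤ _ := by gcongr; exact Real.add_one_le_exp _
  calc 2 * L * Real.exp ((L - y) / (L * (L - 1)))
      ≤ (L + y) * Real.exp ((L - y) / L) * Real.exp ((L - y) / (L * (L - 1))) := by gcongr
    _ = (L + y) * Real.exp ((L - y) / (L * (L - 1)) + (L - y) / L) := by
        rw [Real.exp_add]; ring
    _ ≤ _ := by gcongr

/-- For `L > 1` the sequence `(2L)^n (L - f_L^[n-1](0))` converges to a finite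
positive limit, so that `C(L)` is well defined. -/
theorem stmt18 (L : ℝ) (hL : 1 < L)
    (f : ℝ → ℝ) (hf : f = fun t => Real.sqrt (L ^ 2 - L + t)) :
    ∃ M : ℝ, 0 < M ∧
      Tendsto (fun n : ℕ => (2 * L) ^ (n + 1) * (L - f^[n] 0)) atTop
        (𝓝 M) := by
  have hL0 : 0 < L := by linarith
  have hstep : ∀ t, 0 ≤ t → t ≤ L → 0 ≤ f t ∧ f t ≤ L ∧ L - t = (L - f t) * (L + f t) := by
    subst hf
    exact fun t h0 h1 => sqrt_step hL h0 h1
  have hx : ∀ n, 0 ≤ f^[n] 0 ∧ f^[n] 0 ≤ L := by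
    intro n
    induction n with
    | zero => simpa using hL0.le
    | succ n ih =>
      rw [Function.iterate_succ_apply']
      exact ⟨(hstep _ ih.1 ih.2).1, (hstep _ ih.1 ih.2).2.1⟩
  set a : ℕ → ℝ := fun n => (2 * L) ^ (n + 1) * (L - f^[n] 0) with ha
  have ha0 : ∀ n, 0 ≤ a n := fun n => mul_nonneg (by positivity) (by linarith [(hx n).2])
  have hmono : Monotone a := by
    refine monotone_nat_of_le_succ fun n => ?_
    obtain ⟨h0, h1, h⟩ := hstep _ (hx n).1 (hx n).2
    have hd : 0 ≤ (2 * L) ^ (n + 1) * (L - f (f^[n] 0)) :=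
      mul_nonneg (by positivity) (by linarith)
    simp only [ha]
    rw [Function.iterate_succ_apply', h]
    convert mul_le_mul_of_nonneg_left (show L + f (f^[n] 0) ≤ 2 * L by linarith) hd using 1 <;>
      ring
  have hanti : Antitone fun n => a n * Real.exp ((L - f^[n] 0) / (L * (L - 1))) := by
    refine antitone_nat_of_succ_le fun n => ?_
    obtain ⟨h0, h1, h⟩ := hstep _ (hx n).1 (hx n).2
    have hd : 0 ≤ (2 * L) ^ (n + 1) * (L - f (f^[n] 0)) :=
      mul_nonneg (by positivity) (by linarith)
    simp only [ha]
    rw [Function.iterate_succ_apply', h]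
    convert mul_le_mul_of_nonneg_left (two_mul_mul_exp_le hL h0 h1) hd using 1 <;> ring
  have hbdd : BddAbove (Set.range a) := by
    refine ⟨a 0 * Real.exp ((L - f^[0] 0) / (L * (L - 1))), ?_⟩
    rintro _ ⟨n, rfl⟩
    refine le_trans (le_mul_of_one_le_right (ha0 n) (Real.one_le_exp ?_)) (hanti n.zero_le)
    exact div_nonneg (by linarith [(hx n).2]) (mul_nonneg hL0.le (by linarith))
  refine ⟨⨆ n, a n, lt_of_lt_of_le ?_ (le_ciSup hbdd 0), tendsto_atTop_ciSup hmono hbdd⟩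
  simp only [ha, Function.iterate_zero, id]
  rw [sub_zero]
  positivity
end

section
/- Let L > 1 be a real number, regarded as a point on the real axis in ℂ, and let D_L(L) denote the open disk in ℂ of radius L centered at L. Then for every z ∈ D_L(L), the translated point L² − L + z lies in the open disk D_L(L²) of radius L centered at L², its principal square root (L² − L + z)^{1/2} is well defined, and (L² − L + z)^{1/2} ∈ D_L(L). That is, the map f(z) = √(L² − L + z) (principal branch) maps D_L(L) into itself. -/
open Filter Topology Complex

/-- The map `z ↦ √(L² - L + z)` (principal branch) maps the open disk of
radius `L` centered at `L` into itself. -/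
theorem stmt19 (L : ℝ) (hL : 1 < L) :
    ∀ z ∈ Metric.ball (L : ℂ) L,
      ((L : ℂ) ^ 2 - (L : ℂ) + z) ∈ Metric.ball ((L : ℂ) ^ 2) L ∧
      ((L : ℂ) ^ 2 - (L : ℂ) + z) ∈ Complex.slitPlane ∧
      ((L : ℂ) ^ 2 - (L : ℂ) + z) ^ (1 / 2 : ℂ) ∈ Metric.ball (L : ℂ) L := by
  intro z hz
  simp only [mem_ball_iff_norm] at hz ⊢
  set u : ℂ := (L : ℂ) ^ 2 - (L : ℂ) + z with hu
  have hball : ‖u - (L : ℂ) ^ 2‖ < L := by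
    rwa [show u - (L : ℂ) ^ 2 = z - L by rw [hu]; ring]
  refine ⟨hball, Or.inl ?_, ?_⟩
  · have hre := (abs_le.mp (abs_re_le_norm (u - (L : ℂ) ^ 2))).1
    rw [sub_re, ← ofReal_pow, ofReal_re, ofReal_pow] at hre
    nlinarith
  · rw [one_div]
    set w : ℂ := u ^ (2⁻¹ : ℂ) with hw
    have hsq : w ^ 2 = u := cpow_ofNat_inv_pow u 2
    have hw_re : 0 ≤ w.re := by
      rw [hw, cpow_inv_two_re]
      positivity
    have hsum : L ≤ ‖w + L‖ := by
      have h := re_le_norm (w + L)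
      rw [add_re, ofReal_re] at h
      linarith
    rw [← hsq, sq_sub_sq, norm_mul] at hball
    nlinarith [norm_nonneg (w - L)]
end
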